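/- Let (V,σ) be a braided vector space where dim V = N, with basis e₁,…,e_N, σ(e_i⊗e_j) = q_{ij} e_j⊗e_i for scalars q_{ij} that are (integer) powers of a fixed q ∈ K which is not a root of unity. Define the quantum shuffle product on T(V) by x sh_σ y = Σ_{w ∈ S_{i,j}} T_w(x⊗y) for x ∈ V^{⊗i}, y ∈ V^{⊗j} (sum over (i,j)-shuffles, T_w the braid-group lift). Then the set {l₁ sh_σ ⋯ sh_σ l_r : each l_i a Lyndon word in the basis letters, l₁ ≥ ⋯ ≥ l_r} is a K-linear basis of T⁺(V) = ⊕_{n≥1} V^{⊗n}. -/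

import Mathlib

noncomputable section
variable {K : Type*} [Field K]

/-- `p` is a Lyndon word. -/
def IsLyndon {N : ℕ} (p : List (Fin N)) : Prop :=
  p ≠ [] ∧ ∀ a b : List (Fin N), a ≠ [] → b ≠ [] → p = a ++ b → List.Lex (· < ·) p b

/-- `x ≥ y` in the lexicographic order on words. -/
def WGe {N : ℕ} (x y : List (Fin N)) : Prop :=
  x = y ∨ List.Lex (· < ·) y x

/-- prepend the letter `a` to every word, linearly. -/
def consMap {N : ℕ} (a : Fin N) : (List (Fin N) →₀ K) →ₗ[K] (List (Fin N) →₀ K) :=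
  Finsupp.lmapDomain K K (List.cons a)

/-- the quantum shuffle product of two basis words, for the diagonal braiding
`σ(e_i ⊗ e_j) = Q i j • e_j ⊗ e_i`; it satisfies
`(a∷u) ш (b∷v) = a∷(u ш (b∷v)) + (∏_{c ∈ a∷u} Q c b) • b∷((a∷u) ш v)`,
which is exactly `Σ_{w ∈ S_{i,j}} T_w`. -/
def qshW {N : ℕ} (Q : Fin N → Fin N → K) : List (Fin N) → List (Fin N) → (List (Fin N) →₀ K)
  | [], y => Finsupp.single y 1
  | x, [] => Finsupp.single x 1
  | a :: u, b :: v =>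
      consMap a (qshW Q u (b :: v)) +
        (((a :: u).map fun c => Q c b).prod) • consMap b (qshW Q (a :: u) v)
  termination_by x y => x.length + y.length

/-- the quantum shuffle product, extended bilinearly. -/
def shW {N : ℕ} (Q : Fin N → Fin N → K) :
    (List (Fin N) →₀ K) → (List (Fin N) →₀ K) → (List (Fin N) →₀ K) :=
  fun f g => f.sum fun x a => g.sum fun y b => (a * b) • qshW Q x y

/-- the iterated quantum shuffle product `l₁ ш (l₂ ш (⋯ ш l_r))` of a list of words. -/
def prodShW {N : ℕ} (Q : Fin N → Fin N → K) : List (List (Fin N)) → (List (Fin N) →₀ K)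
  | [] => Finsupp.single [] 1
  | l :: L => shW Q (Finsupp.single l 1) (prodShW Q L)

/-- the index set: decreasing nonempty lists of Lyndon words. -/
def GoodL (N : ℕ) : Type :=
  {L : List (List (Fin N)) // (∀ l ∈ L, IsLyndon l) ∧ List.Chain' WGe L ∧ L ≠ []}

/-! ### Numerical values and slopes of words -/

/-- value of a word in base `N + 2` with digits `a + 1`. -/
def wval {N : ℕ} : List (Fin N) → ℕ
  | [] => 0
  | a :: u => (a.1 + 1) * (N + 2) ^ u.length + wval u

/-- the base power, as a rational. -/
def bpow (N n : ℕ) : ℚ := ((N : ℚ) + 2) ^ n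

/-- the `t`-defect of a word. -/
def dft {N : ℕ} (t : ℚ) (u : List (Fin N)) : ℚ := wval u - t * (bpow N u.length - 1)

/-- wslope of a word. -/
def wslope {N : ℕ} (u : List (Fin N)) : ℚ := wval u / (bpow N u.length - 1)

theorem bpow_add (N m n : ℕ) : bpow N (m + n) = bpow N m * bpow N n := pow_add _ _ _

theorem bpow_zero (N : ℕ) : bpow N 0 = 1 := pow_zero _

theorem bpow_pos (N n : ℕ) : 0 < bpow N n := by unfold bpow; positivity

theorem bpow_ge (N n : ℕ) : 1 ≤ bpow N n := by
  unfold bpow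
  apply one_le_pow₀
  have : (0 : ℚ) ≤ N := Nat.cast_nonneg N
  linarith

theorem bpow_gt (N n : ℕ) (h : n ≠ 0) : 1 < bpow N n := by
  unfold bpow
  apply one_lt_pow₀ _ h
  have : (0 : ℚ) ≤ N := Nat.cast_nonneg N
  linarith

theorem wval_append {N : ℕ} (u v : List (Fin N)) :
    wval (u ++ v) = wval u * (N + 2) ^ v.length + wval v := by
  induction u with
  | nil => simp [wval]
  | cons a u ih => simp only [List.cons_append, wval, ih, List.length_append, pow_add]; ring

theorem dft_nil {N : ℕ} (t : ℚ) : dft t ([] : List (Fin N)) = 0 := by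
  simp [dft, wval, bpow]

theorem dft_append {N : ℕ} (t : ℚ) (u v : List (Fin N)) :
    dft t (u ++ v) = dft t u * bpow N v.length + dft t v := by
  simp only [dft, wval_append, List.length_append, bpow_add]
  push_cast
  simp only [bpow]
  ring

theorem dft_cons {N : ℕ} (t : ℚ) (a : Fin N) (v : List (Fin N)) :
    dft t (a :: v) = dft t [a] * bpow N v.length + dft t v := dft_append t [a] v

theorem wval_lt {N : ℕ} (u : List (Fin N)) : wval u < (N + 2) ^ u.length := by
  induction u with
  | nil => simp [wval]
  | cons a u ih =>
    simp only [wval, List.length_cons, pow_succ]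
    have := a.2
    nlinarith [Nat.pow_pos (n := u.length) (show 0 < N + 2 by omega)]

theorem wval_lex {N : ℕ} {u v : List (Fin N)} (h : List.Lex (· < ·) u v)
    (hl : u.length = v.length) : wval u < wval v := by
  induction h with
  | nil => simp at hl
  | @rel a u b v h =>
    simp only [List.length_cons, Nat.add_right_cancel_iff] at hl
    have h1 := wval_lt u
    have h2 : a.1 + 1 ≤ b.1 := h
    simp only [wval, ← hl]
    nlinarith [Nat.pow_pos (n := u.length) (show 0 < N + 2 by omega)]
  | cons h ih =>
    simp only [List.length_cons, Nat.add_right_cancel_iff] at hl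
    simp only [wval, ← hl]
    have := ih hl
    omega

theorem wlex_tri {N : ℕ} (u v : List (Fin N)) :
    List.Lex (· < ·) u v ∨ u = v ∨ List.Lex (· < ·) v u := by
  rcases lt_trichotomy u v with h | h | h
  · exact Or.inl h
  · exact Or.inr (Or.inl h)
  · exact Or.inr (Or.inr h)

theorem wval_lt_of_length {N : ℕ} {u v : List (Fin N)} (h : u.length < v.length) :
    wval u < wval v := by
  match v with
  | [] => simp at h
  | b :: v =>
    simp only [List.length_cons] at h
    have h1 := wval_lt u
    have h2 : (N + 2) ^ u.length ≤ (N + 2) ^ v.length := Nat.pow_le_pow_right (by omega) (by omega)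
    simp only [wval]
    nlinarith

theorem wval_inj {N : ℕ} {u v : List (Fin N)} (h : wval u = wval v) : u = v := by
  rcases lt_trichotomy u.length v.length with hl | hl | hl
  · have := wval_lt_of_length hl; omega
  · rcases wlex_tri u v with h1 | h1 | h1
    · have := wval_lex h1 hl; omega
    · exact h1
    · have := wval_lex h1 hl.symm; omega
  · have := wval_lt_of_length hl; omega

theorem lex_of_wval {N : ℕ} {u v : List (Fin N)} (hl : u.length = v.length)
    (h : wval u < wval v) : List.Lex (· < ·) u v := by
  rcases wlex_tri u v with h1 | h1 | h1
  · exact h1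
  · subst h1; omega
  · have := wval_lex h1 hl.symm; omega

theorem dft_lt_iff {N : ℕ} (t : ℚ) {u v : List (Fin N)} (hl : u.length = v.length) :
    dft t u < dft t v ↔ wval u < wval v := by
  simp only [dft, hl, sub_lt_sub_iff_right, Nat.cast_lt]

theorem dft_lex {N : ℕ} (t : ℚ) {u v : List (Fin N)} (h : List.Lex (· < ·) u v)
    (hl : u.length = v.length) : dft t u < dft t v := (dft_lt_iff t hl).2 (wval_lex h hl)

theorem bpow_len_gt {N : ℕ} {u : List (Fin N)} (h : u ≠ []) : 1 < bpow N u.length :=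
  bpow_gt _ _ (by simpa using h)

theorem dft_slope {N : ℕ} {l : List (Fin N)} (h : l ≠ []) : dft (wslope l) l = 0 := by
  have := bpow_len_gt h
  unfold dft wslope
  have h2 : bpow N l.length - 1 ≠ 0 := by linarith
  field_simp
  ring

theorem dft_neg_iff {N : ℕ} (t : ℚ) {u : List (Fin N)} (h : u ≠ []) :
    dft t u < 0 ↔ wslope u < t := by
  have := bpow_len_gt h
  unfold dft wslope
  rw [div_lt_iff₀ (by linarith)]
  constructor <;> intro h <;> linarith

theorem dft_pos_iff {N : ℕ} (t : ℚ) {u : List (Fin N)} (h : u ≠ []) :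
    0 < dft t u ↔ t < wslope u := by
  have := bpow_len_gt h
  unfold dft wslope
  rw [lt_div_iff₀ (by linarith)]
  constructor <;> intro h <;> linarith

theorem dft_nonpos_iff {N : ℕ} (t : ℚ) {u : List (Fin N)} (h : u ≠ []) :
    dft t u ≤ 0 ↔ wslope u ≤ t := by
  rw [← not_lt, dft_pos_iff t h, not_lt]

/-! ### Lyndon words -/

theorem lex_append_of_length {N : ℕ} {x s : List (Fin N)} (h : List.Lex (· < ·) x s)
    (hl : s.length ≤ x.length) (r r' : List (Fin N)) : List.Lex (· < ·) (x ++ r) (s ++ r') := by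
  induction h with
  | nil => simp at hl
  | rel h => exact List.Lex.rel h
  | cons h ih => exact List.Lex.cons (ih (by simpa using hl))

theorem lex_cases {N : ℕ} {x s : List (Fin N)} (h : List.Lex (· < ·) x s) :
    x <+: s ∨ ∀ r r' : List (Fin N), List.Lex (· < ·) (x ++ r) (s ++ r') := by
  induction h with
  | nil => simp
  | rel h => exact Or.inr fun r r' => List.Lex.rel h
  | cons h ih =>
    rcases ih with ih | ih
    · left; simpa [List.cons_prefix_cons] using ih
    · exact Or.inr fun r r' => List.Lex.cons (ih r r')

theorem lyndon_prefix {N : ℕ} {p s : List (Fin N)} (h : IsLyndon (p ++ s)) (hp : p ≠ [])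
    (hs : s ≠ []) : dft (wslope (p ++ s)) p < 0 := by
  have h1 := h.2 p s hp hs rfl
  have h2 := lex_append_of_length h1 (by simp) [] p
  rw [List.append_nil] at h2
  have h3 := dft_lex (wslope (p ++ s)) h2 (by simp [add_comm])
  have h4 := dft_slope h.1
  rw [h4] at h3
  rw [dft_append] at h3 h4
  set t := wslope (p ++ s)
  by_contra hc
  push Not at hc
  have e : dft t s = - (dft t p * bpow N s.length) := by linarith
  rw [e] at h3
  have b1 := bpow_ge N s.length
  have b2 := bpow_ge N p.length
  nlinarith [mul_le_mul b1 b2 zero_le_one (by linarith)]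

theorem lyndon_of_prefix {N : ℕ} {l : List (Fin N)} (hl : l ≠ [])
    (h : ∀ p s : List (Fin N), p ≠ [] → s ≠ [] → l = p ++ s → dft (wslope l) p < 0) :
    IsLyndon l := by
  refine ⟨hl, fun a b ha hb hab => ?_⟩
  have h1 := h a b ha hb hab
  have h4 := dft_slope hl
  have h5 := h4
  rw [hab] at h5
  rw [dft_append, ← hab] at h5
  have b1 := bpow_gt N b.length (by simpa using hb)
  have b2 := bpow_gt N a.length (by simpa using ha)
  have e : dft (wslope l) b = - (dft (wslope l) a * bpow N b.length) := by linarith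
  have hbpos : 0 < dft (wslope l) b := by rw [e]; nlinarith
  rcases wlex_tri l b with h2 | h2 | h2
  · exact h2
  · rw [h2] at hab
    have := congrArg List.length hab
    simp at this
    exact absurd this ha
  · exfalso
    rcases lex_cases h2 with ⟨r, hr⟩ | h3
    · by_cases hr0 : r = []
      · subst hr0
        rw [List.append_nil] at hr
        have := congrArg List.length hab
        rw [hr] at this
        simp at this
        exact absurd this ha
      · have := h b r hb hr0 hr.symm
        linarith
    · have h6 := h3 a []
      rw [List.append_nil] at h6
      have h7 := dft_lex (wslope l) h6 (by rw [hab]; simp [add_comm])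
      rw [h4, dft_append] at h7
      nlinarith

theorem lyndon_lt {N : ℕ} {m l : List (Fin N)} (hm : IsLyndon m) (hl : IsLyndon l)
    (h : List.Lex (· < ·) m l) : wslope m < wslope l := by
  rw [← dft_neg_iff _ hm.1]
  rcases lex_cases h with ⟨r, hr⟩ | h3
  · subst hr
    by_cases hr0 : r = []
    · subst hr0
      rw [List.append_nil] at h
      exact absurd h (lt_irrefl m)
    · exact lyndon_prefix hl hm.1 hr0
  · have h6 := dft_lex (wslope l) (h3 l m) (by simp [add_comm])
    rw [dft_append, dft_append, dft_slope hl.1] at h6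
    have := bpow_len_gt hl.1
    nlinarith

theorem lyndon_wge {N : ℕ} {x y : List (Fin N)} (hx : IsLyndon x) (hy : IsLyndon y)
    (h : WGe x y) : wslope y ≤ wslope x := by
  rcases h with h | h
  · rw [h]
  · exact (lyndon_lt hy hx h).le

theorem lyndon_slope_inj {N : ℕ} {x y : List (Fin N)} (hx : IsLyndon x) (hy : IsLyndon y)
    (h : wslope x = wslope y) : x = y := by
  rcases wlex_tri x y with h1 | h1 | h1
  · have := lyndon_lt hx hy h1; linarith
  · exact h1
  · have := lyndon_lt hy hx h1; linarith

theorem lyndon_append {N : ℕ} {u v : List (Fin N)} (hu : IsLyndon u) (hv : IsLyndon v)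
    (h : List.Lex (· < ·) u v) : IsLyndon (u ++ v) := by
  have huv : u ++ v ≠ [] := by simp [hu.1]
  have hs := lyndon_lt hu hv h
  have e := dft_slope huv
  have bv := bpow_len_gt hv.1
  have hu0 : wslope u < wslope (u ++ v) := by
    rw [← dft_neg_iff _ hu.1]
    by_contra hc
    push Not at hc
    have h2 : dft (wslope (u ++ v)) v ≤ 0 := by rw [dft_append] at e; nlinarith
    rw [dft_nonpos_iff _ hv.1] at h2
    rw [← not_lt, dft_neg_iff _ hu.1] at hc
    exact hc (lt_of_lt_of_le hs h2)
  have hv0 : wslope (u ++ v) < wslope v := by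
    rw [← dft_neg_iff _ hu.1] at hu0
    rw [← dft_pos_iff _ hv.1]
    rw [dft_append] at e
    nlinarith
  apply lyndon_of_prefix huv
  intro p s hp hs' heq
  rcases List.append_eq_append_iff.1 heq with ⟨r, hr1, hr2⟩ | ⟨r, hr1, hr2⟩
  · -- p = u ++ r, v = r ++ s
    by_cases hr0 : r = []
    · subst hr0
      rw [hr1, List.append_nil, dft_neg_iff _ hu.1]
      exact hu0
    · have h1 := lyndon_prefix (hr2 ▸ hv) hr0 hs'
      rw [← hr2] at h1
      have h2 := dft_slope hv.1
      rw [hr2] at h2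
      rw [dft_append, ← hr2] at h2
      have bs := bpow_pos N s.length
      have h3 : 0 < dft (wslope v) s := by nlinarith
      rw [dft_pos_iff _ hs'] at h3
      have h4 : 0 < dft (wslope (u ++ v)) s := by
        rw [dft_pos_iff _ hs']; linarith
      have h5 := e
      rw [heq] at h5
      rw [dft_append, ← heq] at h5
      by_contra hc
      push Not at hc
      nlinarith
  · -- u = p ++ r, s = r ++ v
    rw [dft_neg_iff _ hp]
    by_cases hr0 : r = []
    · subst hr0
      rw [List.append_nil] at hr1
      rw [← hr1]; exact hu0
    · have h1 := lyndon_prefix (hr1 ▸ hu) hp hr0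
      rw [← hr1, dft_neg_iff _ hp] at h1
      linarith

/-! ### Factorizations -/

theorem good_slopes {N : ℕ} (l : List (Fin N)) (L : List (List (Fin N)))
    (h1 : ∀ m ∈ l :: L, IsLyndon m) (h2 : List.IsChain WGe (l :: L)) :
    ∀ m ∈ L, wslope m ≤ wslope l := by
  induction L generalizing l with
  | nil => simp
  | cons k L ih =>
    rw [List.isChain_cons_cons] at h2
    have h3 := lyndon_wge (h1 l (by simp)) (h1 k (by simp)) h2.1
    intro m hm
    rcases List.mem_cons.1 hm with rfl | hm
    · exact h3
    · exact (ih k (fun m hm => h1 m (List.mem_cons_of_mem _ hm)) h2.2 m hm).trans h3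

theorem prefix_append_cases {α : Type*} {p u v : List α} (h : p <+: u ++ v) :
    p <+: u ∨ ∃ r, p = u ++ r ∧ r <+: v := by
  obtain ⟨s, hs⟩ := h
  rcases List.append_eq_append_iff.1 hs with ⟨r, hr1, hr2⟩ | ⟨r, hr1, hr2⟩
  · exact Or.inl ⟨r, hr1.symm⟩
  · exact Or.inr ⟨r, hr1, s, hr2.symm⟩

theorem flatten_prefix {N : ℕ} (t : ℚ) (L : List (List (Fin N))) (h1 : ∀ m ∈ L, IsLyndon m)
    (h2 : ∀ m ∈ L, wslope m ≤ t) (p : List (Fin N)) (hp : p <+: L.flatten) : dft t p ≤ 0 := by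
  induction L generalizing p with
  | nil =>
    simp at hp
    subst hp
    rw [dft_nil]
  | cons m L ih =>
    have hm := h1 m (by simp)
    have hmt := h2 m (by simp)
    rw [List.flatten_cons] at hp
    rcases prefix_append_cases hp with ⟨s, hs⟩ | ⟨r, rfl, hr⟩
    · by_cases hp0 : p = []
      · rw [hp0, dft_nil]
      rw [dft_nonpos_iff _ hp0]
      by_cases hs0 : s = []
      · subst hs0
        rw [List.append_nil] at hs
        rw [hs]; exact hmt
      · subst hs
        have := lyndon_prefix hm hp0 hs0
        rw [dft_neg_iff _ hp0] at this
        linarith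
    · have h3 := ih (fun m hm => h1 m (List.mem_cons_of_mem _ hm))
        (fun m hm => h2 m (List.mem_cons_of_mem _ hm)) r hr
      rw [← dft_nonpos_iff _ hm.1] at hmt
      rw [dft_append]
      have := bpow_pos N r.length
      nlinarith

theorem flatten_inj {N : ℕ} (L L' : List (List (Fin N))) (h1 : ∀ m ∈ L, IsLyndon m)
    (h2 : List.IsChain WGe L) (h1' : ∀ m ∈ L', IsLyndon m) (h2' : List.IsChain WGe L')
    (h : L.flatten = L'.flatten) : L = L' := by
  induction L generalizing L' with
  | nil =>
    cases L' with
    | nil => rfl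
    | cons m L' =>
      have := (h1' m (by simp)).1
      simp at h
      exact absurd h.1 this
  | cons l L ih =>
    cases L' with
    | nil =>
      have := (h1 l (by simp)).1
      simp at h
      exact absurd h.1 this
    | cons m L' =>
      have hl := h1 l (by simp)
      have hm := h1' m (by simp)
      have key : l = m := by
        apply lyndon_slope_inj hl hm
        apply le_antisymm
        · rw [← dft_nonpos_iff _ hl.1]
          apply flatten_prefix _ (m :: L') h1'
          · intro k hk
            rcases List.mem_cons.1 hk with rfl | hk
            · exact le_rfl
            · exact good_slopes m L' h1' h2' k hk
          · rw [← h]; simp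
        · rw [← dft_nonpos_iff _ hm.1]
          apply flatten_prefix _ (l :: L) h1
          · intro k hk
            rcases List.mem_cons.1 hk with rfl | hk
            · exact le_rfl
            · exact good_slopes l L h1 h2 k hk
          · rw [h]; simp
      subst key
      congr 1
      apply ih L' (fun m hm => h1 m (List.mem_cons_of_mem _ hm)) h2.tail
        (fun m hm => h1' m (List.mem_cons_of_mem _ hm)) h2'.tail
      simpa using h

theorem good_insert {N : ℕ} (u : List (Fin N)) (hu : IsLyndon u) (L : List (List (Fin N)))
    (h1 : ∀ m ∈ L, IsLyndon m) (h2 : List.IsChain WGe L) :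
    ∃ L' : List (List (Fin N)), (∀ m ∈ L', IsLyndon m) ∧ List.IsChain WGe L' ∧
      L'.flatten = u ++ L.flatten := by
  induction L generalizing u with
  | nil => exact ⟨[u], by simpa using hu, by simp, by simp⟩
  | cons f L ih =>
    rcases wlex_tri u f with h | h | h
    · obtain ⟨L', a, b, c⟩ := ih (u ++ f) (lyndon_append hu (h1 f (by simp)) h)
        (fun m hm => h1 m (List.mem_cons_of_mem _ hm)) h2.tail
      exact ⟨L', a, b, by rw [c]; simp⟩
    · refine ⟨u :: f :: L, ?_, List.isChain_cons_cons.2 ⟨Or.inl h, h2⟩, by simp⟩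
      intro m hm
      rcases List.mem_cons.1 hm with rfl | hm
      · exact hu
      · exact h1 m hm
    · refine ⟨u :: f :: L, ?_, List.isChain_cons_cons.2 ⟨Or.inr h, h2⟩, by simp⟩
      intro m hm
      rcases List.mem_cons.1 hm with rfl | hm
      · exact hu
      · exact h1 m hm

theorem good_exists {N : ℕ} (w : List (Fin N)) :
    ∃ L : List (List (Fin N)), (∀ m ∈ L, IsLyndon m) ∧ List.IsChain WGe L ∧ L.flatten = w := by
  induction w with
  | nil => exact ⟨[], by simp, by simp, by simp⟩
  | cons a w ih =>
    obtain ⟨L, h1, h2, h3⟩ := ih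
    have ha : IsLyndon [a] := by
      refine ⟨by simp, fun x y hx hy hxy => ?_⟩
      have := congrArg List.length hxy
      have := List.length_pos_iff.2 hx
      have := List.length_pos_iff.2 hy
      simp at *
      omega
    obtain ⟨L', a1, b1, c1⟩ := good_insert [a] ha L h1 h2
    exact ⟨L', a1, b1, by rw [c1, h3]; simp⟩

/-! ### Shuffles -/

/-- `x` is a shuffle of `u` and `v`. -/
inductive Shuf {N : ℕ} : List (Fin N) → List (Fin N) → List (Fin N) → Prop
  | nil : Shuf [] [] []
  | left (a : Fin N) {u v x : List (Fin N)} : Shuf u v x → Shuf (a :: u) v (a :: x)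
  | right (b : Fin N) {u v x : List (Fin N)} : Shuf u v x → Shuf u (b :: v) (b :: x)

theorem Shuf.length_eq {N : ℕ} {u v x : List (Fin N)} (h : Shuf u v x) :
    x.length = u.length + v.length := by
  induction h with
  | nil => rfl
  | left a h ih => simp only [List.length_cons, ih]; omega
  | right a h ih => simp only [List.length_cons, ih]; omega

theorem Shuf.nil_left {N : ℕ} (v : List (Fin N)) : Shuf [] v v := by
  induction v with
  | nil => exact Shuf.nil
  | cons b v ih => exact Shuf.right b ih

theorem Shuf.append {N : ℕ} (u v : List (Fin N)) : Shuf u v (u ++ v) := by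
  induction u with
  | nil => exact Shuf.nil_left v
  | cons a u ih => exact Shuf.left a ih

theorem Shuf.nil_right {N : ℕ} (u : List (Fin N)) : Shuf u [] u := by
  simpa using Shuf.append u []

theorem Shuf.mono {N : ℕ} {u y x : List (Fin N)} (h : Shuf u y x) (w : List (Fin N))
    (hl : y.length = w.length) (hlt : List.Lex (· < ·) y w) :
    ∃ x', Shuf u w x' ∧ List.Lex (· < ·) x x' := by
  induction h generalizing w with
  | nil => cases hlt; simp at hl
  | left a h ih =>
    obtain ⟨x', h1, h2⟩ := ih w hl hlt
    exact ⟨a :: x', Shuf.left a h1, List.Lex.cons h2⟩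
  | @right b u v x h ih =>
    cases hlt with
    | @rel _ _ c w h' => exact ⟨c :: (u ++ w), Shuf.right c (Shuf.append u w), List.Lex.rel h'⟩
    | cons h' =>
      obtain ⟨x', h1, h2⟩ := ih _ (by simpa using hl) h'
      exact ⟨b :: x', Shuf.right b h1, List.Lex.cons h2⟩

/-- all prefixes have nonpositive accumulated defect. -/
def PC {N : ℕ} (t α : ℚ) (u : List (Fin N)) : Prop :=
  ∀ p, p <+: u → α * bpow N p.length + dft t p ≤ 0

theorem PC.head {N : ℕ} {t α : ℚ} {u : List (Fin N)} (h : PC t α u) : α ≤ 0 := by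
  have := h [] (by simp)
  simpa [bpow, dft_nil] using this

theorem bpow_succ (N n : ℕ) : bpow N (n + 1) = bpow N 1 * bpow N n := by
  rw [add_comm, bpow_add]

theorem PC.tail {N : ℕ} {t α : ℚ} {a : Fin N} {u : List (Fin N)} (h : PC t α (a :: u)) :
    PC t (α * bpow N 1 + dft t [a]) u := by
  intro p hp
  have := h (a :: p) (by simpa [List.cons_prefix_cons] using hp)
  rw [dft_cons, List.length_cons, bpow_succ] at this
  linarith

theorem Shuf.weak {N : ℕ} (t : ℚ) {u v x : List (Fin N)} (h : Shuf u v x) (α β : ℚ)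
    (hu : PC t α u) (hv : PC t β v) :
    (α + β) * bpow N x.length + dft t x ≤
      α * bpow N u.length + dft t u + (β * bpow N v.length + dft t v) := by
  induction h generalizing α β with
  | nil => simp [bpow, dft_nil]
  | @left a u v x h ih =>
    have h1 := ih _ β hu.tail hv
    have h2 := hv.head
    rw [dft_cons, dft_cons t a u, List.length_cons, List.length_cons, bpow_succ N x.length,
      bpow_succ N u.length]
    have b1 := bpow_ge N 1
    have b2 := bpow_pos N x.length
    have : β * (bpow N 1 * bpow N x.length) ≤ β * bpow N x.length := by
      have : bpow N x.length ≤ bpow N 1 * bpow N x.length := by nlinarith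
      nlinarith
    linarith
  | @right a u v x h ih =>
    have h1 := ih α _ hu hv.tail
    have h2 := hu.head
    rw [dft_cons, dft_cons t a v, List.length_cons, List.length_cons, bpow_succ N x.length,
      bpow_succ N v.length]
    have b1 := bpow_ge N 1
    have b2 := bpow_pos N x.length
    have : α * (bpow N 1 * bpow N x.length) ≤ α * bpow N x.length := by
      have : bpow N x.length ≤ bpow N 1 * bpow N x.length := by nlinarith
      nlinarith
    linarith

/-! ### The product of words -/

theorem consMap_single {N : ℕ} (a : Fin N) (x : List (Fin N)) (c : K) :
    consMap a (Finsupp.single x c) = Finsupp.single (a :: x) c := by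
  simp [consMap]

theorem consMap_supported {N : ℕ} (a : Fin N) {s s' : Set (List (Fin N))}
    (h : ∀ x ∈ s, a :: x ∈ s') {f : List (Fin N) →₀ K} (hf : f ∈ Finsupp.supported K K s) :
    consMap a f ∈ Finsupp.supported K K s' := by
  classical
  rw [Finsupp.mem_supported] at *
  intro y hy
  have := Finsupp.mapDomain_support (f := List.cons a) (s := f) hy
  rw [Finset.mem_image] at this
  obtain ⟨x, hx, rfl⟩ := this
  exact h x (hf hx)

/-- prepend a word. -/
def appMap {N : ℕ} (s : List (Fin N)) : (List (Fin N) →₀ K) →ₗ[K] (List (Fin N) →₀ K) :=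
  Finsupp.lmapDomain K K (fun x => s ++ x)

theorem appMap_single {N : ℕ} (s x : List (Fin N)) (c : K) :
    appMap s (Finsupp.single x c) = Finsupp.single (s ++ x) c := by
  simp [appMap]

theorem appMap_nil {N : ℕ} (f : List (Fin N) →₀ K) : appMap [] f = f := by
  simp only [appMap, Finsupp.lmapDomain_apply, List.nil_append]
  exact Finsupp.mapDomain_id

theorem appMap_cons {N : ℕ} (b : Fin N) (s : List (Fin N)) (f : List (Fin N) →₀ K) :
    appMap (b :: s) f = consMap b (appMap s f) := by
  simp only [appMap, consMap, Finsupp.lmapDomain_apply, ← Finsupp.mapDomain_comp]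
  rfl

theorem appMap_supported {N : ℕ} (w : List (Fin N)) {s s' : Set (List (Fin N))}
    (h : ∀ x ∈ s, w ++ x ∈ s') {f : List (Fin N) →₀ K} (hf : f ∈ Finsupp.supported K K s) :
    appMap w f ∈ Finsupp.supported K K s' := by
  classical
  rw [Finsupp.mem_supported] at *
  intro y hy
  have := Finsupp.mapDomain_support (f := fun x => w ++ x) (s := f) hy
  rw [Finset.mem_image] at this
  obtain ⟨x, hx, rfl⟩ := this
  exact h x (hf hx)

theorem qshW_nil_left {N : ℕ} (Q : Fin N → Fin N → K) (v : List (Fin N)) :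
    qshW Q [] v = Finsupp.single v 1 := by
  unfold qshW; rfl

theorem qshW_nil_right {N : ℕ} (Q : Fin N → Fin N → K) (u : List (Fin N)) :
    qshW Q u [] = Finsupp.single u 1 := by
  cases u with
  | nil => exact qshW_nil_left Q []
  | cons a u => rw [qshW]; simp

/-- crossing factor of a letter. -/
def chi1 {N : ℕ} (Q : Fin N → Fin N → K) (l : List (Fin N)) (b : Fin N) : K :=
  (l.map fun c => Q c b).prod

/-- crossing factor of a word. -/
def chi {N : ℕ} (Q : Fin N → Fin N → K) (l s : List (Fin N)) : K :=
  (s.map fun b => chi1 Q l b).prod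

theorem qshW_cons {N : ℕ} (Q : Fin N → Fin N → K) (a b : Fin N) (u v : List (Fin N)) :
    qshW Q (a :: u) (b :: v) = consMap a (qshW Q u (b :: v)) +
      chi1 Q (a :: u) b • consMap b (qshW Q (a :: u) v) := by
  rw [qshW]; rfl

theorem qshW_supported {N : ℕ} (Q : Fin N → Fin N → K) (u v : List (Fin N)) :
    qshW Q u v ∈ Finsupp.supported K K {x | Shuf u v x} := by
  induction u generalizing v with
  | nil =>
    rw [qshW_nil_left]
    exact Finsupp.single_mem_supported K 1 (Shuf.nil_left v)
  | cons a u ihu =>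
    induction v with
    | nil =>
      rw [qshW_nil_right]
      exact Finsupp.single_mem_supported K 1 (Shuf.nil_right _)
    | cons b v ihv =>
      rw [qshW_cons]
      apply Submodule.add_mem
      · exact consMap_supported a (fun x hx => Shuf.left a hx) (ihu (b :: v))
      · exact Submodule.smul_mem _ _ (consMap_supported b (fun x hx => Shuf.right b hx) ihv)

/-- words of length `n` with defect less than `c`. -/
def lowSet (N : ℕ) (t : ℚ) (n : ℕ) (c : ℚ) : Set (List (Fin N)) :=
  {x | x.length = n ∧ dft t x < c}

theorem low_cons {N : ℕ} (t : ℚ) (n : ℕ) (c c' : ℚ) (a : Fin N)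
    (h : dft t [a] * bpow N n + c ≤ c') {f : List (Fin N) →₀ K}
    (hf : f ∈ Finsupp.supported K K (lowSet N t n c)) :
    consMap a f ∈ Finsupp.supported K K (lowSet N t (n + 1) c') := by
  refine consMap_supported a ?_ hf
  rintro x ⟨rfl, hx⟩
  refine ⟨by simp, ?_⟩
  rw [dft_cons]
  linarith

theorem low_app {N : ℕ} (t : ℚ) (n n' : ℕ) (c : ℚ) (l : List (Fin N)) (hl : dft t l = 0)
    (hn : n' = l.length + n) {f : List (Fin N) →₀ K}
    (hf : f ∈ Finsupp.supported K K (lowSet N t n c)) :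
    appMap l f ∈ Finsupp.supported K K (lowSet N t n' c) := by
  refine appMap_supported l ?_ hf
  rintro x ⟨rfl, hx⟩
  refine ⟨by simp [hn], ?_⟩
  rw [dft_append, hl]
  linarith

/-- all proper prefixes have negative accumulated defect. -/
def SPC {N : ℕ} (t α : ℚ) (u : List (Fin N)) : Prop :=
  ∀ p, p <+: u → p ≠ u → α * bpow N p.length + dft t p < 0

theorem SPC.head {N : ℕ} {t α : ℚ} {a : Fin N} {u : List (Fin N)} (h : SPC t α (a :: u)) :
    α < 0 := by
  have := h [] (by simp) (by simp)
  simpa [bpow, dft_nil] using this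

theorem SPC.tail {N : ℕ} {t α : ℚ} {a : Fin N} {u : List (Fin N)} (h : SPC t α (a :: u)) :
    SPC t (α * bpow N 1 + dft t [a]) u := by
  intro p hp hpu
  have := h (a :: p) (by simpa [List.cons_prefix_cons] using hp) (by simpa using hpu)
  rw [dft_cons, List.length_cons, bpow_succ] at this
  linarith

theorem SPC.pc {N : ℕ} {t α : ℚ} {u : List (Fin N)} (h : SPC t α u)
    (h0 : α * bpow N u.length + dft t u ≤ 0) : PC t α u := by
  intro p hp
  by_cases hpu : p = u
  · rw [hpu]; exact h0
  · exact (h p hp hpu).le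

theorem step_one {N : ℕ} (Q : Fin N → Fin N → K) (t α : ℚ) (u v : List (Fin N))
    (hu : SPC t α u) (hu0 : α * bpow N u.length + dft t u = 0) (hv : PC t 0 v) :
    qshW Q u v - Finsupp.single (u ++ v) 1 ∈ Finsupp.supported K K
      (lowSet N t (u.length + v.length) (dft t v - α * bpow N (u.length + v.length))) := by
  induction u generalizing α with
  | nil => rw [qshW_nil_left, List.nil_append, sub_self]; exact Submodule.zero_mem _
  | cons a u ih =>
    cases v with
    | nil => rw [qshW_nil_right, List.append_nil, sub_self]; exact Submodule.zero_mem _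
    | cons b v =>
      have hα := hu.head
      have e : (a :: u).length + (b :: v).length = (u.length + (b :: v).length) + 1 := by
        simp only [List.length_cons]; omega
      rw [qshW_cons, List.cons_append, ← consMap_single, add_sub_right_comm, ← map_sub]
      apply Submodule.add_mem
      · rw [e]
        have hu1 : (α * bpow N 1 + dft t [a]) * bpow N u.length + dft t u = 0 := by
          rw [dft_cons, List.length_cons, bpow_succ] at hu0
          linarith
        refine low_cons t _ _ _ a ?_ (ih _ hu.tail hu1)
        rw [bpow_succ N (u.length + (b :: v).length)]
        linarith
      · apply Submodule.smul_mem
        refine consMap_supported b ?_ (qshW_supported Q (a :: u) v)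
        intro x hx
        have hx : Shuf (a :: u) v x := hx
        have h1 := hx.weak t α _ (hu.pc hu0.le) hv.tail
        have h2 := hx.length_eq
        refine ⟨by simp only [List.length_cons, h2]; omega, ?_⟩
        have e2 : (a :: u).length + (b :: v).length = x.length + 1 := by
          rw [h2]; simp only [List.length_cons]; omega
        rw [e2, dft_cons, dft_cons t b v, bpow_succ]
        rw [hu0] at h1
        have b1 := bpow_gt N 1 one_ne_zero
        have b2 := bpow_pos N x.length
        have h3 : bpow N x.length < bpow N 1 * bpow N x.length := by nlinarith
        have h4 : α * (bpow N 1 * bpow N x.length) < α * bpow N x.length := by nlinarith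
        linarith

theorem step_two {N : ℕ} (Q : Fin N → Fin N → K) (t β : ℚ) (l s v : List (Fin N)) (hl0 : l ≠ [])
    (hl : PC t 0 l) (hlt : dft t l = 0) (hs : SPC t β s) (hv : PC t β (s ++ v)) :
    qshW Q l (s ++ v) - chi Q l s • appMap s (qshW Q l v) ∈ Finsupp.supported K K
      (lowSet N t (l.length + (s ++ v).length)
        (β * bpow N (s ++ v).length + dft t (s ++ v) -
          β * bpow N (l.length + (s ++ v).length))) := by
  induction s generalizing β with
  | nil =>
    rw [appMap_nil, List.nil_append]
    simp [chi]
  | cons b s ih =>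
    have hβ := hs.head
    have ih' := ih _ hs.tail hv.tail
    obtain ⟨a, u, rfl⟩ := List.exists_cons_of_ne_nil hl0
    have e1 : chi Q (a :: u) (b :: s) = chi1 Q (a :: u) b * chi Q (a :: u) s := by
      simp [chi]
    rw [List.cons_append] at hv ⊢
    have e0 : qshW Q (a :: u) (b :: (s ++ v)) - chi Q (a :: u) (b :: s) •
        appMap (b :: s) (qshW Q (a :: u) v) = consMap a (qshW Q u (b :: (s ++ v))) +
        chi1 Q (a :: u) b • consMap b (qshW Q (a :: u) (s ++ v) -
          chi Q (a :: u) s • appMap s (qshW Q (a :: u) v)) := by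
      rw [qshW_cons, appMap_cons, e1, map_sub, map_smul]
      module
    rw [e0]
    apply Submodule.add_mem
    · refine consMap_supported a ?_ (qshW_supported Q u (b :: (s ++ v)))
      intro x hx
      have hx : Shuf u (b :: (s ++ v)) x := hx
      have h1 := hx.weak t _ β hl.tail hv
      have h2 := hx.length_eq
      refine ⟨by simp only [List.length_cons] at *; omega, ?_⟩
      have e2 : (a :: u).length + (b :: (s ++ v)).length = x.length + 1 := by
        rw [h2]; simp only [List.length_cons]; omega
      rw [e2, dft_cons, bpow_succ N x.length]
      rw [dft_cons] at hlt
      have b1 := bpow_gt N 1 one_ne_zero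
      have b2 := bpow_pos N x.length
      have h3 : bpow N x.length < bpow N 1 * bpow N x.length := by nlinarith
      have h4 : β * (bpow N 1 * bpow N x.length) < β * bpow N x.length := by nlinarith
      linarith
    · apply Submodule.smul_mem
      have e2 : (a :: u).length + (b :: (s ++ v)).length
          = ((a :: u).length + (s ++ v).length) + 1 := by
        simp only [List.length_cons]; omega
      rw [e2]
      refine low_cons t _ _ _ b ?_ ih'
      have e6 : (b :: (s ++ v)).length = (s ++ v).length + 1 := rfl
      rw [dft_cons t b (s ++ v), e6, bpow_succ N (s ++ v).length,
        bpow_succ N ((a :: u).length + (s ++ v).length)]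
      linarith

theorem lyndon_spc {N : ℕ} {l p : List (Fin N)} (hl : IsLyndon l) (hp : p <+: l) (hp0 : p ≠ [])
    (hpl : p ≠ l) : dft (wslope l) p < 0 := by
  obtain ⟨s, rfl⟩ := hp
  exact lyndon_prefix hl hp0 (by rintro rfl; simp at hpl)

theorem lyndon_pc {N : ℕ} {l : List (Fin N)} (hl : IsLyndon l) : PC (wslope l) 0 l := by
  intro p hp
  rw [zero_mul, zero_add]
  by_cases h0 : p = []
  · rw [h0, dft_nil]
  by_cases h1 : p = l
  · rw [h1, dft_slope hl.1]
  · exact (lyndon_spc hl hp h0 h1).le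

theorem lyndon_tail_spc {N : ℕ} {a : Fin N} {u : List (Fin N)} (hl : IsLyndon (a :: u)) :
    SPC (wslope (a :: u)) (dft (wslope (a :: u)) [a]) u := by
  intro p hp hpu
  have := lyndon_spc hl (p := a :: p) (by simpa [List.cons_prefix_cons] using hp) (by simp)
    (by simpa using hpu)
  rwa [dft_cons] at this

theorem lyndon_zero_prefix {N : ℕ} {l s : List (Fin N)} (hl : IsLyndon l) (hs0 : s ≠ [])
    (hs : dft (wslope l) s = 0) : l <+: s := by
  have hl0 := dft_slope hl.1
  have e : s ++ l = l ++ s := by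
    apply wval_inj
    have hlen : (s ++ l).length = (l ++ s).length := by simp [add_comm]
    have h1 : dft (wslope l) (s ++ l) = dft (wslope l) (l ++ s) := by
      rw [dft_append, dft_append, hs, hl0]; simp
    have h2 := dft_lt_iff (wslope l) hlen
    have h3 := dft_lt_iff (wslope l) hlen.symm
    rw [h1] at h2 h3
    simp only [lt_self_iff_false, false_iff, not_lt] at h2 h3
    omega
  have h1 : l <+: s ++ l := by rw [e]; simp
  have h2 : s <+: s ++ l := by simp
  rcases le_total l.length s.length with h | h
  · exact List.prefix_of_prefix_length_le h1 h2 h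
  · have h3 := List.prefix_of_prefix_length_le h2 h1 h
    by_cases h4 : s = l
    · rw [h4]
    · have := lyndon_spc hl h3 hs0 h4
      linarith

theorem main_coeff {N : ℕ} (Q : Fin N → Fin N → K) (l : List (Fin N)) (hl : IsLyndon l) (n : ℕ)
    (w : List (Fin N)) (hn : w.length ≤ n) (hw : PC (wslope l) 0 w) :
    ∃ k : ℕ, qshW Q l w - (∑ j ∈ Finset.range (k + 1), chi Q l l ^ j) •
        Finsupp.single (l ++ w) 1 ∈ Finsupp.supported K K
      (lowSet N (wslope l) (l.length + w.length) (dft (wslope l) w)) := by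
  have hl0 := dft_slope hl.1
  have hpc := lyndon_pc hl
  induction n generalizing w with
  | zero =>
    have : w = [] := by simpa using hn
    subst this
    exact ⟨0, by simp [qshW_nil_right]⟩
  | succ n ih =>
    obtain _ | ⟨b, v⟩ := w
    · exact ⟨0, by simp [qshW_nil_right]⟩
    obtain ⟨a, u, rfl⟩ := List.exists_cons_of_ne_nil hl.1
    set t := wslope (a :: u) with ht
    -- first part
    have hA : consMap a (qshW Q u (b :: v)) - Finsupp.single (a :: u ++ b :: v) 1 ∈
        Finsupp.supported K K (lowSet N t ((a :: u).length + (b :: v).length)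
          (dft t (b :: v))) := by
      have h1 := step_one Q t _ u (b :: v) (lyndon_tail_spc hl)
        (by rw [← ht, ← dft_cons]; exact hl0) hw
      have e : (a :: u).length + (b :: v).length = (u.length + (b :: v).length) + 1 := by
        simp only [List.length_cons]; omega
      rw [e, List.cons_append, ← consMap_single, ← map_sub]
      refine low_cons t _ _ _ a ?_ h1
      linarith
    have hwt := hw.tail
    rw [zero_mul, zero_add] at hwt
    have e3 : (a :: u).length + (b :: v).length = ((a :: u).length + v.length) + 1 := by
      simp only [List.length_cons]; omega
    by_cases hpre : (a :: u) <+: (b :: v)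
    · obtain ⟨w2, hw2⟩ := hpre
      rw [List.cons_append] at hw2
      obtain ⟨rfl, rfl⟩ := List.cons.inj hw2
      have hw2 : PC t 0 w2 := by
        intro p hp
        have := hw (a :: u ++ p) (by simpa using hp)
        rw [dft_append, hl0] at this
        linarith
      obtain ⟨k, hk⟩ := ih w2 (by simp at hn; omega) hw2
      have h2 := step_two Q t _ (a :: u) u w2 hl.1 hpc hl0 (lyndon_tail_spc hl) hwt
      refine ⟨k + 1, ?_⟩
      have h3 := low_cons t _ (dft t [a] * bpow N (u ++ w2).length + dft t (u ++ w2) -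
          dft t [a] * bpow N ((a :: u).length + (u ++ w2).length)) (dft t (a :: (u ++ w2))) a
          (by rw [dft_cons t a (u ++ w2)]; linarith) h2
      rw [← e3, map_sub, map_smul, ← appMap_cons] at h3
      have h4 := low_app t _ ((a :: u).length + (a :: (u ++ w2)).length) _ (a :: u) hl0
        (by simp only [List.length_cons, List.length_append]; omega) hk
      have e4 : dft t w2 = dft t (a :: (u ++ w2)) := by
        rw [← List.cons_append, dft_append, hl0]; ring
      rw [e4, map_sub, map_smul, appMap_single] at h4
      have e5 : chi Q (a :: u) (a :: u) = chi1 Q (a :: u) a * chi Q (a :: u) u := by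
        simp [chi]
      have := Submodule.add_mem _ (Submodule.add_mem _ hA
        (Submodule.smul_mem _ (chi1 Q (a :: u) a) h3))
        (Submodule.smul_mem _ (chi Q (a :: u) (a :: u)) h4)
      convert this using 1
      rw [qshW_cons, Finset.sum_range_succ']
      simp only [pow_succ, ← Finset.sum_mul, pow_zero, e5, List.cons_append]
      module
    · refine ⟨0, ?_⟩
      have hneg : ∀ p, p <+: v → dft t [b] * bpow N p.length + dft t p < 0 := by
        intro p hp
        refine lt_of_le_of_ne (hwt p hp) ?_
        intro hc
        rw [← dft_cons] at hc
        have h1 := lyndon_zero_prefix hl (by simp) hc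
        exact hpre (h1.trans (by simpa [List.cons_prefix_cons] using hp))
      have h2 := step_two Q t (dft t [b]) (a :: u) v [] hl.1 hpc hl0
        (fun p hp _ => hneg p hp) (by rw [List.append_nil]; exact hwt)
      rw [qshW_nil_right, appMap_single, List.append_nil] at h2
      have h3 : chi Q (a :: u) v • Finsupp.single (v ++ (a :: u)) (1 : K) ∈
          Finsupp.supported K K (lowSet N t ((a :: u).length + v.length)
            (dft t [b] * bpow N v.length + dft t v -
              dft t [b] * bpow N ((a :: u).length + v.length))) := by
        apply Submodule.smul_mem
        apply Finsupp.single_mem_supported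
        refine ⟨by simp only [List.length_append]; omega, ?_⟩
        rw [dft_append, hl0, bpow_add]
        have h5 := hneg v (List.prefix_refl v)
        have h6 := bpow_len_gt hl.1
        nlinarith
      have h4 := Submodule.add_mem _ h2 h3
      rw [sub_add_cancel] at h4
      have h5 := low_cons t _ _ (dft t (b :: v)) b
          (by rw [dft_cons t b v]; linarith) h4
      rw [← e3] at h5
      have := Submodule.add_mem _ hA (Submodule.smul_mem _ (chi1 Q (a :: u) b) h5)
      convert this using 1
      rw [qshW_cons]
      simp only [zero_add, Finset.sum_range_one, pow_zero]
      module

/-! ### Triangularity -/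

theorem qsum_ne_zero [CharZero K] (q : K) (hq : ∀ n : ℕ, 0 < n → q ^ n ≠ 1)
    (m : ℤ) (k : ℕ) : (∑ j ∈ Finset.range (k + 1), (q ^ m) ^ j) ≠ 0 := by
  by_cases hm : m = 0
  · subst hm
    simp only [zpow_zero, one_pow, Finset.sum_const, Finset.card_range, nsmul_eq_mul, mul_one]
    exact_mod_cast Nat.succ_ne_zero k
  · intro h
    have h1 := geom_sum_mul (q ^ m) (k + 1)
    rw [h, zero_mul, ← zpow_natCast, ← zpow_mul] at h1
    have h2 : q ^ (m * ((k + 1 : ℕ) : ℤ)) = 1 := by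
      rw [eq_comm, sub_eq_zero] at h1; exact h1
    have h3 : m * ((k + 1 : ℕ) : ℤ) ≠ 0 := mul_ne_zero hm (by positivity)
    set M := m * ((k + 1 : ℕ) : ℤ)
    rcases Int.natAbs_eq M with h4 | h4
    · rw [h4, zpow_natCast] at h2
      exact hq _ (Int.natAbs_pos.2 h3) h2
    · rw [h4, zpow_neg, zpow_natCast, inv_eq_one] at h2
      exact hq _ (Int.natAbs_pos.2 h3) h2

theorem chi_zpow {N : ℕ} (q : K) (hq0 : q ≠ 0) (Q : Fin N → Fin N → K) (z : Fin N → Fin N → ℤ)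
    (hQ : ∀ i j, Q i j = q ^ z i j) (l s : List (Fin N)) : ∃ m : ℤ, chi Q l s = q ^ m := by
  have h1 : ∀ b, ∃ m : ℤ, chi1 Q l b = q ^ m := by
    intro b
    induction l with
    | nil => exact ⟨0, by simp [chi1]⟩
    | cons a l ih =>
      obtain ⟨m, hm⟩ := ih
      refine ⟨z a b + m, ?_⟩
      rw [zpow_add₀ hq0, ← hm, ← hQ]
      simp [chi1]
  induction s with
  | nil => exact ⟨0, by simp [chi]⟩
  | cons b s ih =>
    obtain ⟨m, hm⟩ := ih
    obtain ⟨m', hm'⟩ := h1 b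
    refine ⟨m' + m, ?_⟩
    rw [zpow_add₀ hq0, ← hm, ← hm']
    simp [chi]

/-- words of the same length with smaller value. -/
def downSet {N : ℕ} (w : List (Fin N)) : Set (List (Fin N)) :=
  {x | x.length = w.length ∧ wval x < wval w}

theorem shW_single {N : ℕ} (Q : Fin N → Fin N → K) (l : List (Fin N)) (f : List (Fin N) →₀ K) :
    shW Q (Finsupp.single l 1) f = Finsupp.linearCombination K (qshW Q l) f := by
  unfold shW
  rw [Finsupp.sum_single_index]
  · simp [Finsupp.linearCombination_apply]
  · simp

theorem lowSet_eq {N : ℕ} (t : ℚ) (l w : List (Fin N)) (hl : dft t l = 0) :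
    lowSet N t (l.length + w.length) (dft t w) ⊆ downSet (l ++ w) := by
  rintro x ⟨h1, h2⟩
  have hlen : x.length = (l ++ w).length := by simp [h1]
  refine ⟨hlen, ?_⟩
  rw [← dft_lt_iff t hlen, dft_append, hl]
  linarith

theorem qshW_down {N : ℕ} (Q : Fin N → Fin N → K) (l w y : List (Fin N)) (hl : IsLyndon l)
    (hw : PC (wslope l) 0 w) (hy : y ∈ downSet w) :
    qshW Q l y ∈ Finsupp.supported K K (downSet (l ++ w)) := by
  refine Finsupp.supported_mono ?_ (qshW_supported Q l y)
  intro x hx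
  have hx : Shuf l y x := hx
  obtain ⟨x', h1, h2⟩ := hx.mono w hy.1 (lex_of_wval hy.1 hy.2)
  have e1 := hx.length_eq
  have e2 := h1.length_eq
  have h3 := h1.weak (wslope l) 0 0 (lyndon_pc hl) hw
  have hlen : x.length = x'.length := by rw [e1, e2, hy.1]
  have h4 := dft_lex (wslope l) h2 hlen
  have hl0 := dft_slope hl.1
  apply lowSet_eq (wslope l) l w hl0
  refine ⟨by rw [hlen, e2], ?_⟩
  linarith

theorem prod_triangular {N : ℕ} [CharZero K] (q : K) (hq0 : q ≠ 0)
    (hq : ∀ n : ℕ, 0 < n → q ^ n ≠ 1)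
    (Q : Fin N → Fin N → K) (z : Fin N → Fin N → ℤ) (hQ : ∀ i j, Q i j = q ^ z i j)
    (L : List (List (Fin N))) (h1 : ∀ m ∈ L, IsLyndon m) (h2 : List.IsChain WGe L) :
    ∃ c : K, c ≠ 0 ∧ prodShW Q L - c • Finsupp.single L.flatten 1 ∈
      Finsupp.supported K K (downSet L.flatten) := by
  induction L with
  | nil => exact ⟨1, one_ne_zero, by simp [prodShW]⟩
  | cons l L ih =>
    obtain ⟨c, hc, hL⟩ := ih (fun m hm => h1 m (List.mem_cons_of_mem _ hm)) h2.tail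
    have hl := h1 l (by simp)
    have hw : PC (wslope l) 0 L.flatten := by
      intro p hp
      rw [zero_mul, zero_add]
      exact flatten_prefix _ L (fun m hm => h1 m (List.mem_cons_of_mem _ hm))
        (good_slopes l L h1 h2) p hp
    obtain ⟨k, hk⟩ := main_coeff Q l hl _ L.flatten le_rfl hw
    obtain ⟨m, hm⟩ := chi_zpow q hq0 Q z hQ l l
    have hs := qsum_ne_zero q hq m k
    rw [← hm] at hs
    refine ⟨c * ∑ j ∈ Finset.range (k + 1), chi Q l l ^ j, mul_ne_zero hc hs, ?_⟩
    have hk' := Finsupp.supported_mono (lowSet_eq _ l L.flatten (dft_slope hl.1)) hk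
    have hg : Finsupp.linearCombination K (qshW Q l)
        (prodShW Q L - c • Finsupp.single L.flatten 1) ∈
        Finsupp.supported K K (downSet (l ++ L.flatten)) := by
      rw [Finsupp.linearCombination_apply]
      apply Submodule.sum_mem
      intro y hy
      apply Submodule.smul_mem
      exact qshW_down Q l _ y hl hw ((Finsupp.mem_supported K _).1 hL hy)
    have := Submodule.add_mem _ hg (Submodule.smul_mem _ c hk')
    rw [List.flatten_cons, prodShW, shW_single]
    convert this using 1
    rw [map_sub, map_smul, Finsupp.linearCombination_single]
    module

theorem prod_apply_self {N : ℕ} {f : List (Fin N) →₀ K} {c : K} {w : List (Fin N)}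
    (h : f - c • Finsupp.single w 1 ∈ Finsupp.supported K K (downSet w)) : f w = c := by
  have h1 : (f - c • Finsupp.single w 1 : List (Fin N) →₀ K) w = 0 := by
    by_contra hc
    have := (Finsupp.mem_supported K _).1 h (Finsupp.mem_support_iff.2 hc)
    exact lt_irrefl _ this.2
  simpa [sub_eq_zero] using h1

theorem prod_apply_other {N : ℕ} {f : List (Fin N) →₀ K} {c : K} {w x : List (Fin N)}
    (h : f - c • Finsupp.single w 1 ∈ Finsupp.supported K K (downSet w)) (hne : x ≠ w)
    (hx : ¬ (x.length = w.length ∧ wval x < wval w)) : f x = 0 := by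
  have h1 : (f - c • Finsupp.single w 1 : List (Fin N) →₀ K) x = 0 := by
    by_contra hc
    exact hx ((Finsupp.mem_supported K _).1 h (Finsupp.mem_support_iff.2 hc))
  simpa [sub_eq_zero, Finsupp.single_apply, hne.symm] using h1

theorem stmt13 {N : ℕ} [CharZero K] (q : K) (hq0 : q ≠ 0)
    (hq : ∀ n : ℕ, 0 < n → q ^ n ≠ 1)
    (Q : Fin N → Fin N → K) (z : Fin N → Fin N → ℤ) (hQ : ∀ i j, Q i j = q ^ z i j) :
    -- the products of decreasing sequences of Lyndon words form a basis of `T⁺(V)`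
    LinearIndependent K (fun L : GoodL N => prodShW Q L.1) ∧
    Submodule.span K (Set.range fun L : GoodL N => prodShW Q L.1)
      = LinearMap.ker (Finsupp.lapply ([] : List (Fin N)) :
          (List (Fin N) →₀ K) →ₗ[K] K) := by 
  have tri : ∀ L : GoodL N, ∃ c : K, c ≠ 0 ∧ prodShW Q L.1 - c • Finsupp.single L.1.flatten 1 ∈
      Finsupp.supported K K (downSet L.1.flatten) :=
    fun L => prod_triangular q hq0 hq Q z hQ L.1 L.2.1 L.2.2.1
  have inj : ∀ L L' : GoodL N, L.1.flatten = L'.1.flatten → L = L' := fun L L' h =>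
    Subtype.ext (flatten_inj L.1 L'.1 L.2.1 L.2.2.1 L'.2.1 L'.2.2.1 h)
  have ne : ∀ L : GoodL N, L.1.flatten ≠ [] := by
    rintro ⟨L, h1, h2, h3⟩ h
    obtain ⟨l, L', rfl⟩ := List.exists_cons_of_ne_nil h3
    simp only [List.flatten_cons, List.append_eq_nil_iff] at h
    exact (h1 l (by simp)).1 h.1
  constructor
  · rw [linearIndependent_iff]
    intro g hg
    by_contra hne
    obtain ⟨L, hL, hmax⟩ := Finset.exists_max_image g.support (fun L => wval L.1.flatten)
      (Finsupp.support_nonempty_iff.2 hne)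
    have h1 := DFunLike.congr_fun hg L.1.flatten
    rw [Finsupp.linearCombination_apply, Finsupp.sum, Finsupp.finsetSum_apply,
      Finset.sum_eq_single L] at h1
    · obtain ⟨c, hc, hcL⟩ := tri L
      rw [Finsupp.smul_apply, prod_apply_self hcL, Finsupp.zero_apply, smul_eq_mul,
        mul_eq_zero] at h1
      exact h1.elim (Finsupp.mem_support_iff.1 hL) hc
    · intro L' hL' hLL
      obtain ⟨c, hc, hcL⟩ := tri L'
      rw [Finsupp.smul_apply, prod_apply_other hcL (fun h => hLL (inj _ _ h.symm)), smul_zero]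
      rintro ⟨_, h⟩
      exact absurd (hmax L' hL') (not_le.2 h)
    · intro h
      exact absurd hL h
  · apply le_antisymm
    · rw [Submodule.span_le]
      rintro _ ⟨L, rfl⟩
      obtain ⟨c, hc, hcL⟩ := tri L
      refine prod_apply_other hcL (ne L).symm ?_
      rintro ⟨h, _⟩
      exact ne L (List.length_eq_zero_iff.1 h.symm)
    · have hword : ∀ n : ℕ, ∀ w : List (Fin N), wval w < n → w ≠ [] →
          (Finsupp.single w (1 : K)) ∈
            Submodule.span K (Set.range fun L : GoodL N => prodShW Q L.1) := by
        intro n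
        induction n with
        | zero => intro w h; omega
        | succ n ih =>
          intro w hwn hw
          obtain ⟨L, h1, h2, h3⟩ := good_exists w
          have hL0 : L ≠ [] := by rintro rfl; exact hw (by simpa using h3.symm)
          obtain ⟨c, hc, hcL⟩ := tri ⟨L, h1, h2, hL0⟩
          have h4 : prodShW Q L ∈
              Submodule.span K (Set.range fun L : GoodL N => prodShW Q L.1) :=
            Submodule.subset_span ⟨⟨L, h1, h2, hL0⟩, rfl⟩
          simp only [h3] at hcL
          have h5 : prodShW Q L - c • Finsupp.single w 1 ∈
              Submodule.span K (Set.range fun L : GoodL N => prodShW Q L.1) := by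
            have hsub := (Finsupp.mem_supported K _).1 hcL
            generalize prodShW Q L - c • Finsupp.single w 1 = f at hsub
            rw [← Finsupp.sum_single f]
            apply Submodule.sum_mem
            intro x hx
            have hx' := hsub hx
            rw [← mul_one (f x), ← smul_eq_mul,
              ← Finsupp.smul_single]
            apply Submodule.smul_mem
            apply ih x (lt_of_lt_of_le hx'.2 (by omega))
            rintro rfl
            exact hw (List.length_eq_zero_iff.1 hx'.1.symm)
          have h6 := Submodule.smul_mem _ c⁻¹ (Submodule.sub_mem _ h4 h5)
          rwa [sub_sub_cancel, smul_smul, inv_mul_cancel₀ hc, one_smul] at h6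
      intro f hf
      have hf : f [] = 0 := hf
      rw [← Finsupp.sum_single f]
      apply Submodule.sum_mem
      intro x hx
      rw [← mul_one (f x), ← smul_eq_mul, ← Finsupp.smul_single]
      apply Submodule.smul_mem
      apply hword (wval x + 1) x (by omega)
      rintro rfl
      exact Finsupp.mem_support_iff.1 hx hf
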